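/- arXiv:2307.00733 — 6 statements merged into one kernel-verified Lean document; each statement's English description precedes it below -/
import Mathlib

section
/- Let N be a positive integer, let P be a probability measure on the collection of subsets of [N], and let K be a symmetric N×N real matrix such that for every subset A ⊆ [N], the marginal probability ∑_{S : A ⊆ S ⊆ [N]} P({S}) equals det(K_A). Then K is positive semidefinite and I − K is positive semidefinite, i.e. 0 ⪯ K ⪯ I. -/
open Matrix

/-- The principal minor of an `N × N` matrix `K` indexed by a subset `A ⊆ [N]`. -/
noncomputable def pminor {N : ℕ} (K : Matrix (Fin N) (Fin N) ℝ) (A : Finset (Fin N)) : ℝ :=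
  (K.submatrix (fun i : A => (i : Fin N)) (fun j : A => (j : Fin N))).det

/-- The expansion of `det (1 + t K)` as a generating function of principal minors. -/
theorem det_one_add_smul_eq_sum_pminor {N : ℕ} (K : Matrix (Fin N) (Fin N) ℝ) (t : ℝ) :
    (1 + t • K).det = ∑ A : Finset (Fin N), t ^ A.card * pminor K A := by
  have h := (detRowAlternating (n := Fin N) (R := ℝ)).toMultilinearMap.map_add_univ
    (fun i => (t • K) i) (fun i => (1 : Matrix (Fin N) (Fin N) ℝ) i)
  have h' : (t • K + 1).det = ∑ A : Finset (Fin N),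
      det (of (A.piecewise (t • K).row (1 : Matrix (Fin N) (Fin N) ℝ).row)) := by
    convert! h
  rw [add_comm, h']
  refine Finset.sum_congr rfl fun A _ => ?_
  rw [det_piecewise_one_eq_submatrix_det, submatrix_smul, Pi.smul_apply, Pi.smul_apply,
    det_smul, Fintype.card_coe, pminor]

/-- The probability generating function of the number of points is `s ↦ det (1 + (s - 1) K)`. -/
theorem det_one_add_smul_eq_sum_pow_card {N : ℕ} {P : Finset (Fin N) → ℝ}
    {K : Matrix (Fin N) (Fin N) ℝ}
    (hmarg : ∀ A : Finset (Fin N),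
      (∑ S ∈ Finset.univ.filter (fun S : Finset (Fin N) => A ⊆ S), P S) = pminor K A) (t : ℝ) :
    (1 + t • K).det = ∑ S : Finset (Fin N), P S * (t + 1) ^ S.card := by
  simp_rw [det_one_add_smul_eq_sum_pminor, ← hmarg, Finset.mul_sum, Finset.sum_filter]
  rw [Finset.sum_comm]
  refine Finset.sum_congr rfl fun S _ => ?_
  rw [← Finset.sum_filter, ← Finset.sum_pow_mul_eq_add_pow, Finset.mul_sum]
  refine Finset.sum_congr (by ext; simp) fun A _ => ?_
  rw [one_pow, mul_one, mul_comm]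

/-- A kernel whose principal minors are the marginals of a point process has spectrum in
`[0, 1]`. -/
theorem spectrum_subset_Icc_of_marginals {N : ℕ} {P : Finset (Fin N) → ℝ} (hP0 : ∀ A, 0 ≤ P A)
    (hP1 : ∑ A : Finset (Fin N), P A = 1) {K : Matrix (Fin N) (Fin N) ℝ}
    (hmarg : ∀ A : Finset (Fin N),
      (∑ S ∈ Finset.univ.filter (fun S : Finset (Fin N) => A ⊆ S), P S) = pminor K A) :
    spectrum ℝ K ⊆ Set.Icc 0 1 := by
  intro c hc
  by_contra hout
  have hc0 : c ≠ 0 := by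
    rintro rfl
    exact hout ⟨le_rfl, zero_le_one⟩
  have hpos : 0 < -c⁻¹ + 1 := by
    rcases lt_or_gt_of_ne hc0 with h | h
    · linarith [inv_lt_zero.2 h]
    · have : 1 < c := not_le.1 fun h1 => hout ⟨h.le, h1⟩
      linarith [inv_lt_one_of_one_lt₀ this]
  have hdet : (1 + (-c⁻¹) • K).det ≠ 0 := by
    rw [det_one_add_smul_eq_sum_pow_card hmarg]
    obtain ⟨S, -, hS⟩ := Finset.exists_ne_zero_of_sum_ne_zero (hP1.trans_ne one_ne_zero)
    exact (Finset.sum_pos' (fun A _ => mul_nonneg (hP0 A) (pow_pos hpos _).le)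
      ⟨S, Finset.mem_univ S, mul_pos ((hP0 S).lt_of_ne' hS) (pow_pos hpos _)⟩).ne'
  have hfactor : algebraMap ℝ (Matrix (Fin N) (Fin N) ℝ) c - K = c • (1 + (-c⁻¹) • K) := by
    rw [smul_add, smul_smul, mul_neg, mul_inv_cancel₀ hc0, neg_one_smul,
      Algebra.algebraMap_eq_smul_one, sub_eq_add_neg]
  refine spectrum.mem_iff.1 hc ((isUnit_iff_isUnit_det _).2 (isUnit_iff_ne_zero.2 ?_))
  rw [hfactor, det_smul]
  exact mul_ne_zero (pow_ne_zero _ hc0) hdet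

/-- If `P` is a probability mass function on the subsets of `[N]` and `K` is a symmetric
matrix whose principal minors give the marginal probabilities `P(A ⊆ Y) = det K_A`,
then `0 ⪯ K ⪯ I`. -/
theorem dpp_kernel_necessity {N : ℕ} (hN : 0 < N)
    (P : Finset (Fin N) → ℝ) (hP0 : ∀ A, 0 ≤ P A) (hP1 : ∑ A : Finset (Fin N), P A = 1)
    (K : Matrix (Fin N) (Fin N) ℝ) (hK : K.IsSymm)
    (hmarg : ∀ A : Finset (Fin N),
      (∑ S ∈ Finset.univ.filter (fun S : Finset (Fin N) => A ⊆ S), P S) = pminor K A) :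
    K.PosSemidef ∧ ((1 : Matrix (Fin N) (Fin N) ℝ) - K).PosSemidef := by
  have hspec := spectrum_subset_Icc_of_marginals hP0 hP1 hmarg
  have hH : K.IsHermitian := by rwa [IsHermitian, conjTranspose_eq_transpose_of_trivial]
  have hH' : (1 - K).IsHermitian := isHermitian_one.sub hH
  refine ⟨hH.posSemidef_iff_eigenvalues_nonneg.2 fun i =>
      (hspec (hH.eigenvalues_mem_spectrum_real i)).1,
    hH'.posSemidef_iff_eigenvalues_nonneg.2 fun i => ?_⟩
  have hi := hH'.eigenvalues_mem_spectrum_real i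
  have hmem : 1 - hH'.eigenvalues i ∈ spectrum ℝ K := by
    rw [spectrum.mem_iff] at hi ⊢
    rwa [map_sub, map_one, ← IsUnit.neg_iff, neg_sub, sub_sub_eq_add_sub, add_comm, add_sub_assoc,
      ← neg_sub 1 K, ← sub_eq_add_neg]
  simpa using (hspec hmem).2
end

section
/- Let N be a positive integer, K an N×N real matrix, and A ⊆ [N] with complement Ā = [N] \ A. Then ∑_{S : A ⊆ S ⊆ [N]} (−1)^{|S| − |A|} det(K_S) = (−1)^{|Ā|} det(K − I_{Ā}), where I_{Ā} is the N×N matrix whose restriction to rows and columns in Ā is the identity and which is zero elsewhere. -/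
open Matrix

/-- `I_B`: the `N × N` matrix agreeing with the identity on entries `(i,j)` with
`i, j ∈ B` and zero elsewhere. -/
def idRestrict {N : ℕ} (B : Finset (Fin N)) : Matrix (Fin N) (Fin N) ℝ :=
  Matrix.of fun i j => if i = j ∧ i ∈ B then (1 : ℝ) else 0

/-- The determinant of `M` plus a diagonal matrix, expanded over the principal minors of `M`. -/
theorem det_add_diagonal_eq_sum_minors {n R : Type*} [Fintype n] [DecidableEq n] [CommRing R]
    (M : Matrix n n R) (d : n → R) :
    (M + diagonal d).det =
      ∑ s : Finset n, (∏ i ∈ sᶜ, d i) * (M.submatrix (↑) (↑) : Matrix s s R).det := by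
  change (detRowAlternating : (n → R) [⋀^n]→ₗ[R] R) (M.row + (diagonal d).row) = _
  rw [AlternatingMap.map_add_univ]
  refine Finset.sum_congr rfl fun s _ => ?_
  have hrows : s.piecewise M.row (diagonal d).row =
      fun i => (if i ∈ sᶜ then d i else 1) • s.piecewise M.row (1 : Matrix n n R).row i := by
    ext i j
    by_cases h : i ∈ s <;> simp [h, diagonal_apply, one_apply]
  rw [hrows, AlternatingMap.map_smul_univ, Finset.prod_ite_mem, Finset.univ_inter, smul_eq_mul,
    ← det_piecewise_one_eq_submatrix_det]
  rfl

theorem sub_idRestrict_eq_add_diagonal {N : ℕ} (K : Matrix (Fin N) (Fin N) ℝ)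
    (B : Finset (Fin N)) :
    K - idRestrict B = K + diagonal fun i => if i ∈ B then -1 else 0 := by
  ext i j
  by_cases hij : i = j <;> by_cases hi : i ∈ B <;>
    simp [idRestrict, hij, sub_eq_add_neg] <;> simp_all

/-- For any `N × N` matrix `K` and `A ⊆ [N]` with complement `Ā`,
`∑_{S ⊇ A} (−1)^{|S| − |A|} det K_S = (−1)^{|Ā|} det (K − I_{Ā})`. -/
theorem alternating_sum_over_supersets {N : ℕ} (hN : 0 < N)
    (K : Matrix (Fin N) (Fin N) ℝ) (A : Finset (Fin N)) :
    (∑ S ∈ Finset.univ.filter (fun S : Finset (Fin N) => A ⊆ S),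
        (-1 : ℝ) ^ (S.card - A.card) * pminor K S) =
      (-1 : ℝ) ^ (Aᶜ.card) * (K - idRestrict Aᶜ).det := by
  rw [sub_idRestrict_eq_add_diagonal, det_add_diagonal_eq_sum_minors, Finset.mul_sum,
    Finset.sum_filter]
  refine Finset.sum_congr rfl fun S _ => ?_
  split_ifs with hAS
  · have hprod : ∏ i ∈ Sᶜ, (if i ∈ Aᶜ then (-1 : ℝ) else 0) = (-1) ^ Sᶜ.card := by
      rw [← Finset.prod_const]
      exact Finset.prod_congr rfl fun i hi => if_pos (Finset.compl_subset_compl.mpr hAS hi)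
    have hcard : Aᶜ.card = (S.card - A.card) + Sᶜ.card := by
      have hA := A.card_add_card_compl
      have hS := S.card_add_card_compl
      have := Finset.card_le_card hAS
      omega
    rw [hprod, hcard, pow_add, ← mul_assoc, mul_assoc (_ ^ _), ← mul_pow]
    simp [pminor]
  · obtain ⟨i, hiA, hiS⟩ := Finset.not_subset.mp hAS
    rw [Finset.prod_eq_zero (Finset.mem_compl.mpr hiS) (by simp [hiA]), zero_mul, mul_zero]
end

section
/- Let N be a positive integer and K a symmetric N×N real matrix with 0 ⪯ K ⪯ I (both K and I − K positive semidefinite). Then for every subset A ⊆ [N] with complement Ā = [N] \ A, one has (−1)^{|Ā|} det(K − I_{Ā}) ≥ 0, where I_{Ā} is the N×N matrix whose restriction to rows and columns in Ā is the identity and which is zero elsewhere. -/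
open Matrix

/-- A real square matrix with nonnegative quadratic form (not necessarily symmetric) has
nonnegative determinant. -/
theorem Matrix.det_nonneg_of_forall_dotProduct_mulVec_nonneg {n : Type*} [Fintype n]
    [DecidableEq n] (M : Matrix n n ℝ) (hM : ∀ x : n → ℝ, 0 ≤ x ⬝ᵥ (M *ᵥ x)) : 0 ≤ M.det := by
  by_contra! hneg
  let f : ℝ → ℝ := fun s => (s • M + (1 - s) • (1 : Matrix n n ℝ)).det
  have hf : Continuous f := by
    apply Continuous.matrix_det
    fun_prop
  have hf0 : f 0 = 1 := by simp [f]
  have hf1 : f 1 = M.det := by simp [f]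
  obtain ⟨s, ⟨hs0, hs1⟩, hs⟩ : (0 : ℝ) ∈ f '' Set.Icc 0 1 :=
    intermediate_value_Icc' zero_le_one hf.continuousOn ⟨by rw [hf1]; exact hneg.le, by simp [hf0]⟩
  have hs_lt : s < 1 := by
    refine lt_of_le_of_ne hs1 ?_
    rintro rfl
    exact hneg.ne (hf1 ▸ hs)
  obtain ⟨x, hx, hx0⟩ := Matrix.exists_mulVec_eq_zero_iff.mpr hs
  have hquad : s * (x ⬝ᵥ (M *ᵥ x)) + (1 - s) * (x ⬝ᵥ x) = 0 := by
    simpa [Matrix.add_mulVec, Matrix.smul_mulVec] using congrArg (x ⬝ᵥ ·) hx0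
  have hxx : 0 < x ⬝ᵥ x :=
    lt_of_le_of_ne (Finset.sum_nonneg fun i _ => mul_self_nonneg (x i))
      (Ne.symm (mt dotProduct_self_eq_zero.mp hx))
  have h₁ := mul_nonneg hs0 (hM x)
  have h₂ := mul_pos (sub_pos.mpr hs_lt) hxx
  linarith

/-- The diagonal sign matrix with entry `-1` on `B` and `1` off `B`. -/
def signDiagonal {N : ℕ} (B : Finset (Fin N)) : Matrix (Fin N) (Fin N) ℝ :=
  Matrix.diagonal fun i => if i ∈ B then -1 else 1

theorem det_signDiagonal {N : ℕ} (B : Finset (Fin N)) :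
    (signDiagonal B).det = (-1) ^ B.card := by
  simp [signDiagonal, Matrix.det_diagonal]

theorem dotProduct_signDiagonal_mul_sub_idRestrict_mulVec_nonneg {N : ℕ}
    {K : Matrix (Fin N) (Fin N) ℝ} (hK : K.IsSymm) (hK0 : K.PosSemidef)
    (hK1 : ((1 : Matrix (Fin N) (Fin N) ℝ) - K).PosSemidef) (B : Finset (Fin N))
    (x : Fin N → ℝ) :
    0 ≤ x ⬝ᵥ ((signDiagonal B * (K - idRestrict B)) *ᵥ x) := by
  let u : Fin N → ℝ := fun i => if i ∈ B then 0 else x i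
  let v : Fin N → ℝ := fun i => if i ∈ B then x i else 0
  have hx : x = u + v := by
    ext i
    by_cases hi : i ∈ B <;> simp [u, v, hi]
  have hsign : x ᵥ* signDiagonal B = u - v := by
    ext i
    by_cases hi : i ∈ B <;> simp [signDiagonal, Matrix.vecMul_diagonal, u, v, hi]
  have hrestrict : idRestrict B *ᵥ x = v := by
    ext i
    by_cases hi : i ∈ B <;> simp [idRestrict, Matrix.mulVec, dotProduct, v, hi]
  have horth : u ⬝ᵥ v = 0 :=
    Finset.sum_eq_zero fun i _ => by by_cases hi : i ∈ B <;> simp [u, v, hi]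
  have hsymm : v ⬝ᵥ (K *ᵥ u) = u ⬝ᵥ (K *ᵥ v) := by
    rw [Matrix.dotProduct_mulVec, ← Matrix.mulVec_transpose, hK.eq, dotProduct_comm]
  have hu : 0 ≤ u ⬝ᵥ (K *ᵥ u) := by simpa using hK0.dotProduct_mulVec_nonneg u
  have hv : 0 ≤ v ⬝ᵥ v - v ⬝ᵥ (K *ᵥ v) := by
    simpa [Matrix.sub_mulVec] using hK1.dotProduct_mulVec_nonneg v
  have hexpand : x ⬝ᵥ ((signDiagonal B * (K - idRestrict B)) *ᵥ x)
      = u ⬝ᵥ (K *ᵥ u) + (v ⬝ᵥ v - v ⬝ᵥ (K *ᵥ v)) := by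
    rw [← Matrix.mulVec_mulVec, Matrix.dotProduct_mulVec, hsign, Matrix.sub_mulVec, hrestrict, hx]
    simp only [Matrix.mulVec_add, sub_dotProduct, dotProduct_sub, dotProduct_add]
    linarith
  rw [hexpand]
  exact add_nonneg hu hv

/-- If `K` is symmetric with `0 ⪯ K ⪯ I`, then for every `A ⊆ [N]` with complement `Ā`,
`(−1)^{|Ā|} det (K − I_{Ā}) ≥ 0`. -/
theorem signed_det_nonneg {N : ℕ} (hN : 0 < N)
    (K : Matrix (Fin N) (Fin N) ℝ) (hK : K.IsSymm)
    (hK0 : K.PosSemidef) (hK1 : ((1 : Matrix (Fin N) (Fin N) ℝ) - K).PosSemidef)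
    (A : Finset (Fin N)) :
    0 ≤ (-1 : ℝ) ^ (Aᶜ.card) * (K - idRestrict Aᶜ).det := by
  rw [← det_signDiagonal, ← Matrix.det_mul]
  exact Matrix.det_nonneg_of_forall_dotProduct_mulVec_nonneg _
    (dotProduct_signDiagonal_mul_sub_idRestrict_mulVec_nonneg hK hK0 hK1 Aᶜ)
end

section
/- Let N be a positive integer and K a symmetric N×N real matrix with 0 ⪯ K ⪯ I. Then there exists a probability measure P on the set of subsets of [N] such that for every A ⊆ [N], ∑_{S : A ⊆ S ⊆ [N]} P({S}) = det(K_A); moreover one may take P({A}) = (−1)^{|Ā|} det(K − I_{Ā}) for each A ⊆ [N]. In particular, a symmetric kernel K defines a determinantal point process if and only if 0 ⪯ K ⪯ I. -/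
open Matrix

/-- The matrix whose rows indexed by `A` are those of `K`, the others being those of `L`. -/
def mixRows {N : ℕ} (A : Finset (Fin N)) (K L : Matrix (Fin N) (Fin N) ℝ) :
    Matrix (Fin N) (Fin N) ℝ :=
  of fun i j => if i ∈ A then K i j else L i j

@[simp]
theorem mixRows_apply {N : ℕ} (A : Finset (Fin N)) (K L : Matrix (Fin N) (Fin N) ℝ)
    (i j : Fin N) : mixRows A K L i j = if i ∈ A then K i j else L i j := rfl

/-- Replacing the rows of `K` outside `A` by those of the identity leaves the principal minor. -/
theorem det_mixRows_one {N : ℕ} (K : Matrix (Fin N) (Fin N) ℝ) (A : Finset (Fin N)) :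
    det (mixRows A K 1) = pminor K A := by
  rw [twoBlockTriangular_det (mixRows A K 1) (fun i => i ∈ A)]
  · have h1 : toSquareBlockProp (mixRows A K 1) (fun i => i ∈ A)
        = K.submatrix (fun i : A => (i : Fin N)) (fun j : A => (j : Fin N)) := by
      ext i j
      simp [toSquareBlockProp, toBlock_apply, i.2]
    have h2 : toSquareBlockProp (mixRows A K 1) (fun i => i ∉ A) = 1 := by
      ext i j
      simp [toSquareBlockProp, toBlock_apply, i.2, one_apply, Subtype.ext_iff]
    rw [h1, h2, det_one, mul_one]
    unfold pminor
    congr!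
  · intro i hi j hj
    have hij : i ≠ j := fun h => hi (h ▸ hj)
    simp [hi, hij]

/-- The signed determinant in terms of a matrix mixing rows of `K` and of `1 - K`. -/
theorem neg_one_pow_mul_det_sub_idRestrict {N : ℕ} (K : Matrix (Fin N) (Fin N) ℝ)
    (A : Finset (Fin N)) :
    (-1 : ℝ) ^ (Aᶜ.card) * (K - idRestrict Aᶜ).det = det (mixRows A K (1 - K)) := by
  have h : mixRows A K (1 - K)
      = of fun i j => (if i ∈ A then (1 : ℝ) else -1) * (K - idRestrict Aᶜ) i j := by
    ext i j
    by_cases hi : i ∈ A <;> simp [hi, idRestrict, one_apply]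
  rw [h, det_mul_column, Finset.prod_ite]
  simp [Finset.filter_notMem_eq_sdiff, Finset.compl_eq_univ_sdiff]

/-- Summing over all supersets of `A` yields the principal minor indexed by `A`. -/
theorem sum_superset_det_mixRows {N : ℕ} (K : Matrix (Fin N) (Fin N) ℝ)
    (A : Finset (Fin N)) :
    ∑ S ∈ Finset.univ.filter (fun S : Finset (Fin N) => A ⊆ S), det (mixRows S K (1 - K))
      = pminor K A := by
  set L := mixRows A 0 (1 - K) with hL
  have hadd : mixRows A K 1 = K + L := by
    ext i j
    by_cases hi : i ∈ A <;> simp [hL, hi]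
  have hsum : det (K + L) = ∑ S : Finset (Fin N), det (mixRows S K L) := by
    refine ((detRowAlternating (R := ℝ) (n := Fin N)).toMultilinearMap.map_add_univ K L).trans
      (Finset.sum_congr rfl fun S _ => congrArg det ?_)
    ext i j
    by_cases hi : i ∈ S <;> simp [Finset.piecewise, hi]
  rw [← det_mixRows_one, hadd, hsum, Finset.sum_filter]
  refine Finset.sum_congr rfl fun S _ => ?_
  split_ifs with hS
  · congr 1
    ext i j
    by_cases hi : i ∈ S
    · simp [hi]
    · have hiA : i ∉ A := fun h => hi (hS h)
      simp [hL, hi, hiA]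
  · obtain ⟨i, hiA, hiS⟩ := Finset.not_subset.mp hS
    refine (det_eq_zero_of_row_eq_zero i fun j => ?_).symm
    simp [hL, hiA, hiS]

theorem pminor_nonneg {N : ℕ} {K : Matrix (Fin N) (Fin N) ℝ} (hK : K.PosSemidef)
    (A : Finset (Fin N)) : 0 ≤ pminor K A :=
  (hK.submatrix _).det_nonneg

theorem Matrix.PosDef.posSemidef_inv_sub_one {N : ℕ} {K : Matrix (Fin N) (Fin N) ℝ}
    (hK : K.PosDef) (hK1 : (1 - K).PosSemidef) : (K⁻¹ - 1).PosSemidef := by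
  have hu : IsUnit K.det := hK.det_pos.ne'.isUnit
  have hH : (K⁻¹ - 1)ᴴ = K⁻¹ - 1 := hK.isHermitian.inv.sub isHermitian_one
  have h := hK1.add (hK.posSemidef.conjTranspose_mul_mul_same (K⁻¹ - 1))
  have e : (1 - K) + (K⁻¹ - 1)ᴴ * K * (K⁻¹ - 1) = K⁻¹ - 1 := by
    rw [hH, sub_mul, nonsing_inv_mul _ hu, sub_mul, one_mul, one_mul, mul_sub, mul_one,
      mul_nonsing_inv _ hu]
    abel
  rwa [e] at h

theorem Matrix.PosDef.det_mixRows_one_sub_nonneg {N : ℕ} {K : Matrix (Fin N) (Fin N) ℝ}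
    (hK : K.PosDef) (hK1 : (1 - K).PosSemidef) (A : Finset (Fin N)) :
    0 ≤ det (mixRows A K (1 - K)) := by
  have hu : IsUnit K.det := hK.det_pos.ne'.isUnit
  have hfac : mixRows A K (1 - K) = mixRows Aᶜ (K⁻¹ - 1) 1 * K := by
    ext i j
    by_cases hi : i ∈ A
    · have h : ((1 : Matrix (Fin N) (Fin N) ℝ) * K) i j = K i j := by rw [one_mul]
      simpa [hi, mul_apply] using h.symm
    · have h : ((K⁻¹ - 1) * K) i j = (1 - K) i j := by
        rw [sub_mul, nonsing_inv_mul _ hu, one_mul]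
      simpa [hi, mul_apply] using h.symm
  rw [hfac, det_mul, det_mixRows_one]
  exact mul_nonneg (pminor_nonneg (hK.posSemidef_inv_sub_one hK1) _) hK.det_pos.le

theorem Matrix.PosSemidef.det_mixRows_one_sub_nonneg {N : ℕ} {K : Matrix (Fin N) (Fin N) ℝ}
    (hK : K.PosSemidef) (hK1 : (1 - K).PosSemidef) (A : Finset (Fin N)) :
    0 ≤ det (mixRows A K (1 - K)) := by
  let Kt : ℝ → Matrix (Fin N) (Fin N) ℝ := fun t => (1 - t) • K + t • 1
  have hKt : Continuous Kt := by fun_prop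
  have hcont : Continuous fun t => det (mixRows A (Kt t) (1 - Kt t)) := by
    refine Continuous.matrix_det (continuous_matrix fun i j => ?_)
    by_cases hi : i ∈ A
    · simpa only [mixRows_apply, hi, if_true] using hKt.matrix_elem i j
    · simp only [mixRows_apply, hi, if_false, sub_apply]
      exact continuous_const.sub (hKt.matrix_elem i j)
  have hlim : Filter.Tendsto (fun t => det (mixRows A (Kt t) (1 - Kt t)))
      (nhdsWithin 0 (Set.Ioi 0)) (nhds (det (mixRows A K (1 - K)))) := by
    have h := (hcont.tendsto 0).mono_left (nhdsWithin_le_nhds (s := Set.Ioi 0))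
    simpa [Kt] using h
  refine ge_of_tendsto hlim ?_
  filter_upwards [Ioo_mem_nhdsGT (zero_lt_one' ℝ)] with t ht
  have hpos : (Kt t).PosDef :=
    PosDef.posSemidef_add (hK.smul (sub_nonneg.mpr ht.2.le)) (PosDef.one.smul ht.1)
  refine hpos.det_mixRows_one_sub_nonneg ?_ A
  have e : 1 - Kt t = (1 - t) • (1 - K) := by
    simp only [Kt]
    module
  rw [e]
  exact hK1.smul (sub_nonneg.mpr ht.2.le)

/-- Sufficiency: any symmetric `K` with `0 ⪯ K ⪯ I` defines a determinantal point process,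
namely the probability mass function `P({A}) = (−1)^{|Ā|} det(K − I_{Ā})` on the subsets of
`[N]`, whose marginals `∑_{S ⊇ A} P({S})` are the principal minors `det K_A`. -/
theorem dpp_kernel_sufficiency {N : ℕ} (hN : 0 < N)
    (K : Matrix (Fin N) (Fin N) ℝ) (hK : K.IsSymm)
    (hK0 : K.PosSemidef) (hK1 : ((1 : Matrix (Fin N) (Fin N) ℝ) - K).PosSemidef) :
    ∃ P : Finset (Fin N) → ℝ,
      (∀ A, 0 ≤ P A) ∧
      (∑ A : Finset (Fin N), P A = 1) ∧
      (∀ A : Finset (Fin N),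
        (∑ S ∈ Finset.univ.filter (fun S : Finset (Fin N) => A ⊆ S), P S) = pminor K A) ∧
      (∀ A : Finset (Fin N), P A = (-1 : ℝ) ^ (Aᶜ.card) * (K - idRestrict Aᶜ).det) := by
  refine ⟨fun A => det (mixRows A K (1 - K)), hK0.det_mixRows_one_sub_nonneg hK1, ?_,
    sum_superset_det_mixRows K, fun A => (neg_one_pow_mul_det_sub_idRestrict K A).symm⟩
  simpa [pminor] using sum_superset_det_mixRows K ∅
end

section
/- Let p̂_0, p̂_1, p̂_2, p̂_3 be strictly positive reals with p̂_0 + p̂_1 + p̂_2 + p̂_3 = 1, and define f(a,b,c) = p̂_1 log a + p̂_2 log c + p̂_3 log(ac − b²) − log((a+1)(c+1) − b²) on the domain {(a,b,c) : a > 0, c > 0, ac − b² > 0}. Then the point (â, b̂, ĉ) = ( (p̂_1 + p̂_3)/(p̂_0 + p̂_2), 0, (p̂_2 + p̂_3)/(p̂_0 + p̂_1) ) lies in the domain and is a critical point of f: all three partial derivatives ∂f/∂a, ∂f/∂b, ∂f/∂c vanish there. -/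
/-- The scaled log-likelihood of a 2×2 L-ensemble with kernel `[[a,b],[b,c]]` and
empirical probabilities `p0, p1, p2, p3` of `∅, {1}, {2}, {1,2}`. -/
noncomputable def loglik2 (p1 p2 p3 a b c : ℝ) : ℝ :=
  p1 * Real.log a + p2 * Real.log c + p3 * Real.log (a * c - b ^ 2)
    - Real.log ((a + 1) * (c + 1) - b ^ 2)

theorem loglik2_swap (p1 p2 p3 a b c : ℝ) :
    loglik2 p1 p2 p3 a b c = loglik2 p2 p1 p3 c b a := by
  unfold loglik2
  rw [mul_comm a c, mul_comm (a + 1) (c + 1)]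
  ring

theorem hasDerivAt_loglik2_fst (p1 p2 p3 : ℝ) {a b c : ℝ} (ha : a ≠ 0)
    (hdet : a * c - b ^ 2 ≠ 0) (hD : (a + 1) * (c + 1) - b ^ 2 ≠ 0) :
    HasDerivAt (fun a => loglik2 p1 p2 p3 a b c)
      (p1 / a + p3 * (c / (a * c - b ^ 2)) - (c + 1) / ((a + 1) * (c + 1) - b ^ 2)) a := by
  have h₁ := ((hasDerivAt_id' a).log ha).const_mul p1
  have h₂ := ((((hasDerivAt_id' a).mul_const c).sub_const (b ^ 2)).log hdet).const_mul p3
  have h₃ := ((((hasDerivAt_id' a).add_const 1).mul_const (c + 1)).sub_const (b ^ 2)).log hD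
  exact (((h₁.add_const (p2 * Real.log c)).add h₂).sub h₃).congr_deriv (by ring)

theorem hasDerivAt_loglik2_snd (p1 p2 p3 : ℝ) {a b c : ℝ}
    (hdet : a * c - b ^ 2 ≠ 0) (hD : (a + 1) * (c + 1) - b ^ 2 ≠ 0) :
    HasDerivAt (fun b => loglik2 p1 p2 p3 a b c)
      (-(2 * b) * (p3 / (a * c - b ^ 2) - 1 / ((a + 1) * (c + 1) - b ^ 2))) b := by
  have h₂ := (((hasDerivAt_pow 2 b).const_sub (a * c)).log hdet).const_mul p3
  have h₃ := ((hasDerivAt_pow 2 b).const_sub ((a + 1) * (c + 1))).log hD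
  exact ((h₂.const_add (p1 * Real.log a + p2 * Real.log c)).sub h₃).congr_deriv
    (by push_cast; ring)

/-- At `b = 0` the partial derivative in `a` vanishes as soon as `a` is the odds ratio of
the marginal probability `p1 + p3` of containing `1`. -/
theorem deriv_loglik2_fst_eq_zero {p1 p3 q c : ℝ} (p2 : ℝ) (h : 0 < p1 + p3) (hq : 0 < q)
    (hsum : p1 + p3 + q = 1) (hc : 0 < c) :
    deriv (fun a => loglik2 p1 p2 p3 a 0 c) ((p1 + p3) / q) = 0 := by
  have ha : 0 < (p1 + p3) / q := by positivity
  have ha1 : (p1 + p3) / q + 1 = 1 / q := by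
    rw [div_add_one hq.ne', hsum]
  rw [(hasDerivAt_loglik2_fst p1 p2 p3 ha.ne' (b := 0) (c := c)
    (by rw [zero_pow two_ne_zero, sub_zero]; positivity)
    (by rw [zero_pow two_ne_zero, sub_zero]; positivity)).deriv, ha1,
    zero_pow two_ne_zero, sub_zero, sub_zero]
  field_simp
  ring

/-- The point `(â, b̂, ĉ) = ((p̂1+p̂3)/(p̂0+p̂2), 0, (p̂2+p̂3)/(p̂0+p̂1))` lies in the
domain `{a > 0, c > 0, ac − b² > 0}` and is a critical point of the 2×2 scaled
log-likelihood: all three partial derivatives vanish there. -/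
theorem critical_point_diagonal (p0 p1 p2 p3 : ℝ)
    (h0 : 0 < p0) (h1 : 0 < p1) (h2 : 0 < p2) (h3 : 0 < p3)
    (hsum : p0 + p1 + p2 + p3 = 1) :
    let ahat := (p1 + p3) / (p0 + p2)
    let bhat := (0 : ℝ)
    let chat := (p2 + p3) / (p0 + p1)
    0 < ahat ∧ 0 < chat ∧ 0 < ahat * chat - bhat ^ 2 ∧
    deriv (fun a => loglik2 p1 p2 p3 a bhat chat) ahat = 0 ∧
    deriv (fun b => loglik2 p1 p2 p3 ahat b chat) bhat = 0 ∧
    deriv (fun c => loglik2 p1 p2 p3 ahat bhat c) chat = 0 := by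
  intro ahat bhat chat
  have ha : 0 < ahat := by positivity
  have hc : 0 < chat := by positivity
  have hdet : 0 < ahat * chat - bhat ^ 2 := by
    simp only [bhat, zero_pow two_ne_zero, sub_zero]
    positivity
  refine ⟨ha, hc, hdet, ?_, ?_, ?_⟩
  · exact deriv_loglik2_fst_eq_zero p2 (by positivity) (by positivity) (by linarith) hc
  · rw [(hasDerivAt_loglik2_snd p1 p2 p3 hdet.ne' (by linarith)).deriv]
    simp [bhat]
  · simp only [loglik2_swap p1 p2 p3]
    exact deriv_loglik2_fst_eq_zero p1 (by positivity) (by positivity) (by linarith) ha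
end

section
/- Let p̂_0, p̂_1, p̂_2, p̂_3 be strictly positive reals with p̂_0 + p̂_1 + p̂_2 + p̂_3 = 1 and p̂_1 p̂_2 − p̂_0 p̂_3 > 0, and define f(a,b,c) = p̂_1 log a + p̂_2 log c + p̂_3 log(ac − b²) − log((a+1)(c+1) − b²) on the domain {(a,b,c) : a > 0, c > 0, ac − b² > 0}. Then the point (â, b̂, ĉ) = ( p̂_1/p̂_0, √(p̂_1 p̂_2 − p̂_0 p̂_3)/p̂_0, p̂_2/p̂_0 ) lies in the domain and is a critical point of f: all three partial derivatives ∂f/∂a, ∂f/∂b, ∂f/∂c vanish there. -/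
theorem hasDerivAt_loglik2_left (p1 p2 p3 : ℝ) {a b c : ℝ} (ha : a ≠ 0)
    (hdet : a * c - b ^ 2 ≠ 0) (hD : (a + 1) * (c + 1) - b ^ 2 ≠ 0) :
    HasDerivAt (fun x => loglik2 p1 p2 p3 x b c)
      (p1 / a + p3 * (c / (a * c - b ^ 2)) - (c + 1) / ((a + 1) * (c + 1) - b ^ 2)) a := by
  have h₁ : HasDerivAt (fun x => x * c - b ^ 2) c a := by
    simpa using ((hasDerivAt_id a).mul_const c).sub_const (b ^ 2)
  have h₂ : HasDerivAt (fun x => (x + 1) * (c + 1) - b ^ 2) (c + 1) a := by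
    simpa using (((hasDerivAt_id a).add_const 1).mul_const (c + 1)).sub_const (b ^ 2)
  exact (((((Real.hasDerivAt_log ha).const_mul p1).add_const (p2 * Real.log c)).add
    ((h₁.log hdet).const_mul p3)).sub (h₂.log hD)).congr_deriv (by rw [div_eq_mul_inv p1])

theorem hasDerivAt_loglik2_offDiag (p1 p2 p3 : ℝ) {a b c : ℝ}
    (hdet : a * c - b ^ 2 ≠ 0) (hD : (a + 1) * (c + 1) - b ^ 2 ≠ 0) :
    HasDerivAt (fun x => loglik2 p1 p2 p3 a x c)
      (p3 * (-(2 * b) / (a * c - b ^ 2)) - -(2 * b) / ((a + 1) * (c + 1) - b ^ 2)) b := by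
  have h (k : ℝ) : HasDerivAt (fun x => k - x ^ 2) (-(2 * b)) b := by
    simpa using (hasDerivAt_pow 2 b).const_sub k
  exact ((((h (a * c)).log hdet).const_mul p3).const_add
    (p1 * Real.log a + p2 * Real.log c)).sub ((h _).log hD)

/-- If moreover `p̂1 p̂2 − p̂0 p̂3 > 0`, the point
`(â, b̂, ĉ) = (p̂1/p̂0, √(p̂1 p̂2 − p̂0 p̂3)/p̂0, p̂2/p̂0)` lies in the domain
`{a > 0, c > 0, ac − b² > 0}` and is a critical point of the 2×2 scaled
log-likelihood: all three partial derivatives vanish there. -/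
theorem critical_point_mle (p0 p1 p2 p3 : ℝ)
    (h0 : 0 < p0) (h1 : 0 < p1) (h2 : 0 < p2) (h3 : 0 < p3)
    (hsum : p0 + p1 + p2 + p3 = 1) (hdet : 0 < p1 * p2 - p0 * p3) :
    let ahat := p1 / p0
    let bhat := Real.sqrt (p1 * p2 - p0 * p3) / p0
    let chat := p2 / p0
    0 < ahat ∧ 0 < chat ∧ 0 < ahat * chat - bhat ^ 2 ∧
    deriv (fun a => loglik2 p1 p2 p3 a bhat chat) ahat = 0 ∧
    deriv (fun b => loglik2 p1 p2 p3 ahat b chat) bhat = 0 ∧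
    deriv (fun c => loglik2 p1 p2 p3 ahat bhat c) chat = 0 := by
  intro ahat bhat chat
  have hb : bhat ^ 2 = (p1 * p2 - p0 * p3) / p0 ^ 2 := by
    simp only [bhat, div_pow, Real.sq_sqrt hdet.le]
  have hac : ahat * chat - bhat ^ 2 = p3 / p0 := by
    rw [hb]
    simp only [ahat, chat]
    field_simp
    ring
  have hD : (ahat + 1) * (chat + 1) - bhat ^ 2 = 1 / p0 := by
    have : (ahat + 1) * (chat + 1) - bhat ^ 2
        = (ahat * chat - bhat ^ 2) + ahat + chat + 1 := by ring
    rw [this, hac]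
    simp only [ahat, chat]
    field_simp
    linarith
  have ha : 0 < ahat := div_pos h1 h0
  have hc : 0 < chat := div_pos h2 h0
  have hac_pos : 0 < ahat * chat - bhat ^ 2 := hac ▸ div_pos h3 h0
  have hD_pos : 0 < (ahat + 1) * (chat + 1) - bhat ^ 2 := hD ▸ one_div_pos.2 h0
  refine ⟨ha, hc, hac_pos, ?_, ?_, ?_⟩
  · rw [(hasDerivAt_loglik2_left p1 p2 p3 ha.ne' hac_pos.ne' hD_pos.ne').deriv, hac, hD]
    simp only [ahat, chat]
    field_simp
    ring
  · rw [(hasDerivAt_loglik2_offDiag p1 p2 p3 hac_pos.ne' hD_pos.ne').deriv, hac, hD]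
    field_simp
    ring
  · simp only [loglik2_swap p1 p2 p3 ahat bhat]
    rw [mul_comm] at hac hac_pos
    rw [mul_comm] at hD hD_pos
    rw [(hasDerivAt_loglik2_left p2 p1 p3 hc.ne' hac_pos.ne' hD_pos.ne').deriv, hac, hD]
    simp only [ahat, chat]
    field_simp
    ring
end
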